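/- Let n ≥ 1 be an integer and let δ ≤ 0 be a real number. Then for every r > 0 one has sn_δ(r)^n ≤ n·cs_δ(r)·∫₀^r sn_δ(t)^{n−1} dt. (This is the right inequality of Lemma 2.5(i) of the paper.) -/

import Mathlib

open Real intervalIntegral

/-- `sn_δ` from the paper. -/
noncomputable def snDelta (δ t : ℝ) : ℝ :=
  if 0 < δ then Real.sin (Real.sqrt δ * t) / Real.sqrt δ
  else if δ = 0 then t
  else Real.sinh (Real.sqrt (-δ) * t) / Real.sqrt (-δ)

/-- `cs_δ`, the derivative of `sn_δ`. -/
noncomputable def csDelta (δ t : ℝ) : ℝ :=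
  if 0 < δ then Real.cos (Real.sqrt δ * t)
  else if δ = 0 then 1
  else Real.cosh (Real.sqrt (-δ) * t)

theorem hasDerivAt_snDelta (δ t : ℝ) : HasDerivAt (snDelta δ) (csDelta δ t) t := by
  rcases lt_trichotomy 0 δ with h | rfl | h
  · have hs : √δ ≠ 0 := (Real.sqrt_pos.2 h).ne'
    have hsn : snDelta δ = fun t => Real.sin (√δ * t) / √δ := by ext; simp [snDelta, h]
    rw [hsn]
    refine (((hasDerivAt_id' t).const_mul √δ).sin.div_const √δ).congr_deriv ?_
    simp [csDelta, h, hs]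
  · have hsn : snDelta 0 = fun t => t := by ext; simp [snDelta]
    rw [hsn]
    simpa [csDelta] using hasDerivAt_id' t
  · have hs : √(-δ) ≠ 0 := (Real.sqrt_pos.2 (neg_pos.2 h)).ne'
    have hsn : snDelta δ = fun t => Real.sinh (√(-δ) * t) / √(-δ) := by
      ext; simp [snDelta, h.not_gt, h.ne]
    rw [hsn]
    refine (((hasDerivAt_id' t).const_mul √(-δ)).sinh.div_const √(-δ)).congr_deriv ?_
    simp [csDelta, h.not_gt, h.ne, hs]

theorem continuous_snDelta (δ : ℝ) : Continuous (snDelta δ) :=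
  continuous_iff_continuousAt.2 fun t => (hasDerivAt_snDelta δ t).continuousAt

theorem continuous_csDelta (δ : ℝ) : Continuous (csDelta δ) := by
  unfold csDelta
  split_ifs <;> fun_prop

@[simp]
theorem snDelta_zero_right (δ : ℝ) : snDelta δ 0 = 0 := by
  simp [snDelta]

theorem snDelta_nonneg {δ t : ℝ} (hδ : δ ≤ 0) (ht : 0 ≤ t) : 0 ≤ snDelta δ t := by
  unfold snDelta
  rw [if_neg hδ.not_gt]
  split_ifs
  · exact ht
  · exact div_nonneg (Real.sinh_nonneg_iff.2 (by positivity)) (Real.sqrt_nonneg _)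

theorem csDelta_monotoneOn {δ : ℝ} (hδ : δ ≤ 0) : MonotoneOn (csDelta δ) (Set.Ici 0) := by
  intro s hs t ht hst
  rw [Set.mem_Ici] at hs ht
  simp only [csDelta, if_neg hδ.not_gt]
  split_ifs
  · exact le_rfl
  · rw [Real.cosh_le_cosh, abs_of_nonneg (by positivity), abs_of_nonneg (by positivity)]
    gcongr

theorem snDelta_pow_eq_integral (δ r : ℝ) {n : ℕ} (hn : n ≠ 0) :
    snDelta δ r ^ n = ∫ t in (0:ℝ)..r, n * snDelta δ t ^ (n - 1) * csDelta δ t := by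
  have hcont : Continuous fun t => n * snDelta δ t ^ (n - 1) * csDelta δ t :=
    (((continuous_snDelta δ).pow _).const_mul _).mul (continuous_csDelta δ)
  rw [integral_eq_sub_of_hasDerivAt (fun t _ => (hasDerivAt_snDelta δ t).fun_pow n)
    (hcont.intervalIntegrable 0 r)]
  simp [hn]

/-- Right inequality of Lemma 2.5(i):
for `n ≥ 1`, `δ ≤ 0` and `r > 0`,
`sn_δ(r)^n ≤ n·cs_δ(r)·∫₀^r sn_δ(t)^{n-1} dt`. -/
theorem sn_rel_nonpos_right (n : ℕ) (hn : 1 ≤ n) (δ : ℝ) (hδ : δ ≤ 0)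
    (r : ℝ) (hr : 0 < r) :
    snDelta δ r ^ n ≤
      (n : ℝ) * csDelta δ r * (∫ t in (0:ℝ)..r, snDelta δ t ^ (n - 1)) := by
  have hsn := (continuous_snDelta δ).pow (n - 1)
  rw [snDelta_pow_eq_integral δ r (Nat.one_le_iff_ne_zero.1 hn), ← integral_const_mul]
  refine integral_mono_on hr.le
    (((hsn.const_mul _).mul (continuous_csDelta δ)).intervalIntegrable 0 r)
    ((hsn.const_mul _).intervalIntegrable 0 r) fun t ht => ?_
  have hcs : csDelta δ t ≤ csDelta δ r :=
    csDelta_monotoneOn hδ (Set.mem_Ici.2 ht.1) (Set.mem_Ici.2 hr.le) ht.2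
  have hpow : 0 ≤ snDelta δ t ^ (n - 1) := pow_nonneg (snDelta_nonneg hδ ht.1) _
  calc n * snDelta δ t ^ (n - 1) * csDelta δ t
      ≤ n * snDelta δ t ^ (n - 1) * csDelta δ r := by gcongr
    _ = n * csDelta δ r * snDelta δ t ^ (n - 1) := by ring
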